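/- arXiv:1705.07204 — 3 statements merged into one kernel-verified Lean document; each statement's English description precedes it below -/
import Mathlib

section
/- Let d and k be positive integers, let v ∈ {-1, 1}^d, and let α ∈ (0, 1). Suppose there exist k pairwise orthogonal vectors r_1, …, r_k ∈ {-1, 1}^d (orthogonal with respect to the standard inner product on ℝ^d) such that ⟨v, r_i⟩ ≥ α · d for every i. Then α ≤ k^(−1/2). -/
/-- Pythagoras for pairwise orthogonal vectors of the same squared length. -/
lemma sum_sq_sum_of_pairwise_orthogonal {ι κ : Type*} [Fintype ι] [Fintype κ]
    (r : ι → κ → ℝ) (c : ℝ) (hsq : ∀ i, ∑ j, r i j * r i j = c)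
    (horth : ∀ i i', i ≠ i' → ∑ j, r i j * r i' j = 0) :
    ∑ j, (∑ i, r i j) ^ 2 = Fintype.card ι * c := by
  simp_rw [sq, Finset.sum_mul_sum]
  rw [Finset.sum_comm]
  have h (i : ι) : ∑ j, ∑ i', r i j * r i' j = c := by
    rw [Finset.sum_comm, Finset.sum_eq_single i (fun i' _ hi => horth i i' hi.symm) (by simp),
      hsq i]
  simp [h]

/-- Lemma 3 of the paper: if `v ∈ {-1,1}^d` and `r 1, …, r k ∈ {-1,1}^d` are pairwise
orthogonal vectors with `⟨v, r i⟩ ≥ α · d` for all `i`, where `α ∈ (0,1)`, then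
`α ≤ k ^ (-1/2)`. -/
theorem alignment_upper_bound
    (d k : ℕ) (hd : 0 < d) (hk : 0 < k)
    (v : Fin d → ℝ) (hv : ∀ j, v j = 1 ∨ v j = -1)
    (α : ℝ) (hα : α ∈ Set.Ioo (0 : ℝ) 1)
    (r : Fin k → Fin d → ℝ)
    (hr : ∀ i j, r i j = 1 ∨ r i j = -1)
    (horth : ∀ i i', i ≠ i' → ∑ j, r i j * r i' j = 0)
    (halign : ∀ i, α * d ≤ ∑ j, v j * r i j) :
    α ≤ (k : ℝ) ^ (-(1 : ℝ) / 2) := by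
  obtain ⟨hα0, -⟩ := hα
  have hd' : (0 : ℝ) < d := by exact_mod_cast hd
  have hk' : (0 : ℝ) < k := by exact_mod_cast hk
  have hsq (w : Fin d → ℝ) (hw : ∀ j, w j = 1 ∨ w j = -1) : ∑ j, w j * w j = d := by
    simp [fun j => mul_self_eq_one_iff.mpr (hw j)]
  have hpyth : ∑ j, (∑ i, r i j) ^ 2 = k * d := by
    simpa using sum_sq_sum_of_pairwise_orthogonal r d (fun i => hsq (r i) (hr i)) horth
  have hlow : k * (α * d) ≤ ∑ j, v j * ∑ i, r i j := by
    simp_rw [Finset.mul_sum]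
    rw [Finset.sum_comm]
    simpa using Finset.sum_le_sum fun i (_ : i ∈ Finset.univ) => halign i
  have hexpand : ∑ j, (v j - α * ∑ i, r i j) ^ 2 =
      d - 2 * α * ∑ j, v j * ∑ i, r i j + α ^ 2 * (k * d) := by
    rw [← hpyth, ← hsq v hv, Finset.mul_sum, Finset.mul_sum, ← Finset.sum_sub_distrib,
      ← Finset.sum_add_distrib]
    exact Finset.sum_congr rfl fun j _ => by ring
  have hnonneg : 0 ≤ ∑ j, (v j - α * ∑ i, r i j) ^ 2 :=
    Finset.sum_nonneg fun j _ => sq_nonneg _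
  have hmain : α ^ 2 * k ≤ 1 := by
    have := mul_le_mul_of_nonneg_left hlow hα0.le
    refine le_of_mul_le_mul_right ?_ hd'
    linarith
  rw [neg_div, Real.rpow_neg hk'.le, ← Real.sqrt_eq_rpow, ← Real.sqrt_inv]
  apply Real.le_sqrt_of_sq_le
  rwa [← one_div, le_div_iff₀ hk']
end

section
/- Let k and d be positive integers with k ∣ d, and suppose there exists a regular Hadamard matrix H of order k, i.e., a k × k matrix with all entries in {-1, 1}, pairwise orthogonal rows (equivalently H ⬝ Hᵀ = k · I), and all row sums equal to √k. Then for every v ∈ {-1, 1}^d there exist k pairwise orthogonal vectors r_1, …, r_k ∈ {-1, 1}^d such that ⟨v, r_i⟩ = d · k^(−1/2) for every i. Explicitly, one may take r_i to be the vector obtained by repeating the i-th row of H exactly d/k times and multiplying component-wise by v. -/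
/-- Summing a `k`-periodic function over `m` periods gives `m` times the sum over one period. -/
theorem Fin.sum_mod_eq_mul_sum {R : Type*} [Semiring R] {m k : ℕ} (hk : 0 < k) (f : Fin k → R) :
    ∑ j : Fin (m * k), f ⟨(j : ℕ) % k, Nat.mod_lt _ hk⟩ = (m : R) * ∑ i, f i := by
  have h : ∀ p : Fin m × Fin k,
      f ⟨(finProdFinEquiv p : ℕ) % k, Nat.mod_lt _ hk⟩ = f p.2 := by
    rintro ⟨a, b⟩
    congr 1
    ext
    simp [finProdFinEquiv, Nat.mod_eq_of_lt b.isLt]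
  rw [← Equiv.sum_comp finProdFinEquiv]
  simp_rw [h]
  simp [Fintype.sum_prod_type]


/-- Deterministic part of Lemma 4 of the paper: given a regular Hadamard matrix `H` of
order `k` (entries in `{-1,1}`, `H * Hᵀ = k • 1`, all row sums `√k`) and `k ∣ d`,
for every `v ∈ {-1,1}^d` there are `k` pairwise orthogonal vectors
`r 1, …, r k ∈ {-1,1}^d` with `⟨v, r i⟩ = d · k ^ (-1/2)`; explicitly one may take
`r i` to repeat the `i`-th row of `H` exactly `d/k` times, multiplied coordinatewise
by `v`. -/
theorem hadamard_construction
    (d k : ℕ) (hd : 0 < d) (hk : 0 < k) (hdvd : k ∣ d)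
    (H : Matrix (Fin k) (Fin k) ℝ)
    (hH1 : ∀ i j, H i j = 1 ∨ H i j = -1)
    (hH2 : H * H.transpose = (k : ℝ) • 1)
    (hH3 : ∀ i, ∑ j, H i j = Real.sqrt k) :
    ∀ v : Fin d → ℝ, (∀ j, v j = 1 ∨ v j = -1) →
      ∃ r : Fin k → Fin d → ℝ,
        (∀ i j, r i j = 1 ∨ r i j = -1) ∧
        (∀ i i', i ≠ i' → ∑ j, r i j * r i' j = 0) ∧
        (∀ i, ∑ j, v j * r i j = (d : ℝ) * (k : ℝ) ^ (-(1 : ℝ) / 2)) ∧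
        (∀ i j, r i j = v j * H i ⟨(j : ℕ) % k, Nat.mod_lt _ hk⟩) := by
  intro v hv
  obtain ⟨m, rfl⟩ := dvd_iff_exists_eq_mul_left.mp hdvd
  have hv2 : ∀ j, v j * v j = 1 := fun j => mul_self_eq_one_iff.mpr (hv j)
  refine ⟨fun i j => v j * H i ⟨(j : ℕ) % k, Nat.mod_lt _ hk⟩, ?_, ?_, ?_, fun _ _ => rfl⟩
  · intro i j
    rcases hv j with h | h <;>
      rcases hH1 i ⟨(j : ℕ) % k, Nat.mod_lt _ hk⟩ with h' | h' <;> simp [h, h']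
  · intro i i' hne
    have hrow : ∑ l, H i l * H i' l = 0 := by
      have := congrFun (congrFun hH2 i) i'
      simpa [Matrix.mul_apply, Matrix.one_apply_ne hne] using this
    simp_rw [mul_mul_mul_comm, hv2, one_mul]
    rw [Fin.sum_mod_eq_mul_sum hk (fun l => H i l * H i' l), hrow, mul_zero]
  · intro i
    have hk' : (0 : ℝ) < k := Nat.cast_pos.mpr hk
    have hsqrt : Real.sqrt k = k * (k : ℝ) ^ (-(1 : ℝ) / 2) := by
      rw [Real.sqrt_eq_rpow, ← Real.rpow_one_add' hk'.le (by norm_num)]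
      norm_num
    simp_rw [← mul_assoc, hv2, one_mul]
    rw [Fin.sum_mod_eq_mul_sum hk (H i), hH3, hsqrt, Nat.cast_mul, mul_assoc]
end

section
/- Tightness of the alignment bound: let k and d be positive integers with k ∣ d, and suppose a regular Hadamard matrix of order k exists. Then for every v ∈ {-1, 1}^d, the maximal α such that there exist k pairwise orthogonal vectors r_1, …, r_k ∈ {-1, 1}^d with ⟨v, r_i⟩ ≥ α · d for all i is exactly k^(−1/2); i.e., α = k^(−1/2) is attained and no α > k^(−1/2) is attainable. -/
theorem sum_comp_fst_finProdFinEquiv_symm (k m : ℕ) (f : Fin k → ℝ) :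
    ∑ j : Fin (k * m), f (finProdFinEquiv.symm j).1 = m * ∑ a, f a := by
  rw [Equiv.sum_comp finProdFinEquiv.symm (fun p : Fin k × Fin m => f p.1),
    Fintype.sum_prod_type]
  simp [Finset.mul_sum]

theorem sum_sq_sum_of_orthogonal {ι κ : Type*} [Fintype ι] [Fintype κ] (r : κ → ι → ℝ)
    (horth : ∀ i i', i ≠ i' → ∑ j, r i j * r i' j = 0) :
    ∑ j, (∑ i, r i j) ^ 2 = ∑ i, ∑ j, r i j ^ 2 := by
  simp_rw [sq, Finset.sum_mul_sum]
  rw [Finset.sum_comm]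
  refine Finset.sum_congr rfl fun i _ => ?_
  rw [Finset.sum_comm]
  exact Finset.sum_eq_single i (fun i' _ h => horth i i' h.symm) (by simp)

/-- Cauchy-Schwarz applied to `v` and the sum of the `r i`. -/
theorem alignment_le_inv_sqrt {ι κ : Type*} [Fintype ι] [Fintype κ] [Nonempty ι] [Nonempty κ]
    (v : ι → ℝ) (hv : ∀ j, v j ^ 2 = 1) (r : κ → ι → ℝ) (hr : ∀ i j, r i j ^ 2 = 1)
    (horth : ∀ i i', i ≠ i' → ∑ j, r i j * r i' j = 0) {α : ℝ}
    (hα : ∀ i, α * Fintype.card ι ≤ ∑ j, v j * r i j) :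
    α ≤ (√(Fintype.card κ : ℝ))⁻¹ := by
  have hd : (0 : ℝ) < Fintype.card ι := by exact_mod_cast Fintype.card_pos
  have hk : (0 : ℝ) < Fintype.card κ := by exact_mod_cast Fintype.card_pos
  have hcs := Finset.sum_mul_sq_le_sq_mul_sq Finset.univ v (fun j => ∑ i, r i j)
  rw [sum_sq_sum_of_orthogonal r horth] at hcs
  simp only [hv, hr, Finset.sum_const, Finset.card_univ, nsmul_eq_mul, mul_one] at hcs
  have hlow : Fintype.card κ * (α * Fintype.card ι) ≤ ∑ j, v j * ∑ i, r i j := by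
    simp_rw [Finset.mul_sum]
    rw [Finset.sum_comm]
    simpa using Finset.sum_le_sum fun i (_ : i ∈ Finset.univ) => hα i
  have hsq : (√(Fintype.card κ : ℝ)) ^ 2 = Fintype.card κ := Real.sq_sqrt hk.le
  have hpos : 0 < √(Fintype.card κ : ℝ) := Real.sqrt_pos.2 hk
  have hup : ∑ j, v j * ∑ i, r i j ≤ Fintype.card ι * √(Fintype.card κ : ℝ) := by
    refine abs_le_of_sq_le_sq' (hcs.trans_eq ?_) (by positivity) |>.2
    rw [mul_pow, hsq]
    ring
  rw [← one_div, le_div_iff₀ hpos]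
  refine le_of_mul_le_mul_right ?_ (mul_pos hd hpos)
  calc α * √(Fintype.card κ : ℝ) * (Fintype.card ι * √(Fintype.card κ : ℝ))
      = √(Fintype.card κ : ℝ) ^ 2 * (α * Fintype.card ι) := by ring
    _ ≤ 1 * (Fintype.card ι * √(Fintype.card κ : ℝ)) := by
      rw [hsq, one_mul]
      exact hlow.trans hup


/-- Tightness of the alignment bound: assuming a regular Hadamard matrix of order `k`
exists and `k ∣ d`, for every `v ∈ {-1,1}^d` the maximal `α` such that there exist `k`
pairwise orthogonal vectors `r i ∈ {-1,1}^d` with `⟨v, r i⟩ ≥ α · d` for all `i` is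
exactly `k ^ (-1/2)`: it is attained, and no larger `α` is attainable. -/
theorem alignment_bound_tight
    (d k : ℕ) (hd : 0 < d) (hk : 0 < k) (hdvd : k ∣ d)
    (H : Matrix (Fin k) (Fin k) ℝ)
    (hH1 : ∀ i j, H i j = 1 ∨ H i j = -1)
    (hH2 : H * H.transpose = (k : ℝ) • 1)
    (hH3 : ∀ i, ∑ j, H i j = Real.sqrt k)
    (v : Fin d → ℝ) (hv : ∀ j, v j = 1 ∨ v j = -1) :
    IsGreatest
      {α : ℝ | ∃ r : Fin k → Fin d → ℝ,
        (∀ i j, r i j = 1 ∨ r i j = -1) ∧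
        (∀ i i', i ≠ i' → ∑ j, r i j * r i' j = 0) ∧
        (∀ i, α * d ≤ ∑ j, v j * r i j)}
      ((k : ℝ) ^ (-(1 : ℝ) / 2)) := by
  have hsq : ∀ x : ℝ, x = 1 ∨ x = -1 → x ^ 2 = 1 := fun x hx => by
    rcases hx with rfl | rfl <;> norm_num
  have hrpow : (k : ℝ) ^ (-(1 : ℝ) / 2) = (√(k : ℝ))⁻¹ := by
    rw [neg_div, Real.rpow_neg k.cast_nonneg, Real.sqrt_eq_rpow]
  rw [hrpow]
  constructor
  · obtain ⟨m, rfl⟩ := hdvd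
    refine ⟨fun i j => v j * H i (finProdFinEquiv.symm j).1, fun i j => ?_, fun i i' h => ?_,
      fun i => ?_⟩
    · rcases hv j with h | h <;> rcases hH1 i (finProdFinEquiv.symm j).1 with h' | h' <;>
        simp only [h, h'] <;> norm_num
    · have hHH : ∑ a, H i a * H i' a = 0 := by
        simpa [Matrix.mul_apply, Matrix.one_apply_ne h] using congrFun₂ hH2 i i'
      calc _ = ∑ j : Fin (k * m),
              H i (finProdFinEquiv.symm j).1 * H i' (finProdFinEquiv.symm j).1 :=
            Finset.sum_congr rfl fun j _ => by rw [mul_mul_mul_comm, ← sq, hsq _ (hv j), one_mul]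
        _ = 0 := by
          rw [sum_comp_fst_finProdFinEquiv_symm k m fun a => H i a * H i' a, hHH, mul_zero]
    · simp_rw [← mul_assoc, ← sq, hsq _ (hv _), one_mul]
      rw [sum_comp_fst_finProdFinEquiv_symm k m (H i), hH3, Nat.cast_mul, ← mul_assoc,
        inv_mul_eq_div, Real.div_sqrt, mul_comm]
  · rintro α ⟨r, hr, horth, hα⟩
    have : Nonempty (Fin d) := ⟨⟨0, hd⟩⟩
    have : Nonempty (Fin k) := ⟨⟨0, hk⟩⟩
    simpa using alignment_le_inv_sqrt v (fun j => hsq _ (hv j)) r (fun i j => hsq _ (hr i j)) horth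
      (by simpa using hα)
end
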